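/- arXiv:2312.16786 — 2 statements merged into one kernel-verified Lean document; each statement's English description precedes it below -/
import Mathlib

section
/- Let n ≥ 1, let I ⊆ [n-1] be nonempty, set m = max(I) and I⁻ = I \ {m}. Then d(I;n) = Σ_{β ∈ PF↑_n} ( Σ_{X} d_X(I⁻;m) ) − d(I⁻;n), where the inner sum runs over all size-m sub-multisets X of the multiset of entries of β, and d_X(I⁻;m) is the number of words of length m using each element of X with its multiplicity whose descent set is exactly I⁻. -/
open scoped Classical

/-- `f : Fin n → Fin n` (entries 0-indexed, value `v` encodes preference `v+1`) is a
parking function: some rearrangement `f ∘ σ` is nondecreasing and its `i`-th entry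
(0-indexed) is at most `i`. -/
def IsPF {n : ℕ} (f : Fin n → Fin n) : Prop :=
  ∃ σ : Equiv.Perm (Fin n), Monotone (f ∘ σ) ∧ ∀ i : Fin n, (f (σ i) : ℕ) ≤ (i : ℕ)

/-- The (1-indexed) descent set of a tuple `a_1, …, a_k`: the indices `i ∈ [k-1]`
with `a_i > a_{i+1}`.  (Here `a_i = f ⟨i-1, _⟩`.) -/
def desSet {k : ℕ} {α : Type*} [LT α] (f : Fin k → α) : Set ℕ :=
  {i | ∃ h : 1 ≤ i ∧ i < k, f ⟨i, h.2⟩ < f ⟨i - 1, (Nat.sub_le i 1).trans_lt h.2⟩}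

/-- `d(I;n)`: the number of parking functions of length `n` with descent set exactly `I`. -/
noncomputable def dCount (n : ℕ) (I : Finset ℕ) : ℕ :=
  (Finset.univ.filter (fun f : Fin n → Fin n => IsPF f ∧ desSet f = ↑I)).card

theorem Multiset.map_univ_eq_ofFn {k : ℕ} {α : Type*} (f : Fin k → α) :
    (Finset.univ.val.map f : Multiset α) = List.ofFn f := by
  simp [Fin.univ_val_map]

theorem Monotone.eq_of_map_univ_eq {k : ℕ} {α : Type*} [LinearOrder α] {f g : Fin k → α}
    (hf : Monotone f) (hg : Monotone g)
    (h : (Finset.univ.val.map f : Multiset α) = Finset.univ.val.map g) : f = g := by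
  rw [Multiset.map_univ_eq_ofFn, Multiset.map_univ_eq_ofFn, Multiset.coe_eq_coe] at h
  exact List.ofFn_injective (h.eq_of_sortedLE hf.sortedLE_ofFn hg.sortedLE_ofFn)

theorem Multiset.exists_monotone_map_univ_eq {k : ℕ} {α : Type*} [LinearOrder α]
    (s : Multiset α) (hs : s.card = k) :
    ∃ f : Fin k → α, Monotone f ∧ (Finset.univ.val.map f : Multiset α) = s := by
  subst hs
  have hl : (s.sort (· ≤ ·)).length = s.card := s.length_sort _
  refine ⟨fun i => (s.sort (· ≤ ·)).get (i.cast hl.symm), fun i j hij => ?_, ?_⟩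
  · exact (s.pairwise_sort (· ≤ ·)).sortedLE.monotone_get (by simpa using hij)
  · rw [Multiset.map_univ_eq_ofFn, ← List.ofFn_congr hl, List.ofFn_get, Multiset.sort_eq]

theorem Multiset.map_univ_comp_perm {k : ℕ} {α : Type*} (f : Fin k → α)
    (σ : Equiv.Perm (Fin k)) :
    (Finset.univ.val.map (f ∘ σ) : Multiset α) = Finset.univ.val.map f := by
  rw [← Multiset.map_map, Multiset.map_univ_val_equiv]

theorem Multiset.map_univ_append {m k : ℕ} {α : Type*} (g : Fin m → α) (h : Fin k → α) :
    (Finset.univ.val.map (Fin.append g h) : Multiset α)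
      = Finset.univ.val.map g + Finset.univ.val.map h := by
  simp only [Multiset.map_univ_eq_ofFn, List.ofFn_fin_append, Multiset.coe_add]

theorem append_comp_castAdd {m k : ℕ} {α : Type*} (g : Fin m → α) (h : Fin k → α) :
    Fin.append g h ∘ Fin.castAdd k = g :=
  funext (Fin.append_left g h)

theorem exists_append_eq {m k : ℕ} {α : Type*} (f : Fin (m + k) → α) :
    ∃ (g : Fin m → α) (h : Fin k → α), Fin.append g h = f :=
  ⟨_, _, Fin.append_castAdd_natAdd⟩

theorem IsPF.comp_perm {n : ℕ} {f : Fin n → Fin n} (hf : IsPF f) (τ : Equiv.Perm (Fin n)) :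
    IsPF (f ∘ τ) := by
  obtain ⟨σ, hσ, hle⟩ := hf
  refine ⟨σ.trans τ.symm, ?_, fun i => ?_⟩
  · simpa [Function.comp_def] using hσ
  · simpa using hle i

theorem isPF_comp_perm_iff {n : ℕ} {f : Fin n → Fin n} (τ : Equiv.Perm (Fin n)) :
    IsPF (f ∘ τ) ↔ IsPF f :=
  ⟨fun h => by simpa [Function.comp_assoc] using h.comp_perm τ.symm, fun h => h.comp_perm τ⟩

theorem comp_sort_eq_iff {k : ℕ} {α : Type*} [LinearOrder α] {f g : Fin k → α}
    (hg : Monotone g) :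
    f ∘ Tuple.sort f = g ↔ (Finset.univ.val.map f : Multiset α) = Finset.univ.val.map g := by
  refine ⟨fun h => ?_, fun h => ?_⟩
  · rw [← h, Multiset.map_univ_comp_perm]
  · exact (Tuple.monotone_sort f).eq_of_map_univ_eq hg
      ((Multiset.map_univ_comp_perm f _).trans h)

theorem mem_desSet_append_of_lt {m k : ℕ} {α : Type*} [LT α] (g : Fin m → α) (h : Fin k → α)
    {i : ℕ} (hi : i < m) : i ∈ desSet (Fin.append g h) ↔ i ∈ desSet g := by
  have key : ∀ j (hj : j < m), Fin.append g h ⟨j, by omega⟩ = g ⟨j, hj⟩ := fun j hj =>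
    Fin.append_left g h ⟨j, hj⟩
  simp only [desSet, Set.mem_ofPred_eq]
  constructor
  · rintro ⟨⟨h1, _⟩, hlt⟩
    rw [key i hi, key (i - 1) (by omega)] at hlt
    exact ⟨⟨h1, hi⟩, hlt⟩
  · rintro ⟨⟨h1, _⟩, hlt⟩
    refine ⟨⟨h1, by omega⟩, ?_⟩
    rwa [key i hi, key (i - 1) (by omega)]

theorem mem_desSet_append_add {m k : ℕ} {α : Type*} [LT α] (g : Fin m → α) (h : Fin k → α)
    {i : ℕ} (hi : 1 ≤ i) : m + i ∈ desSet (Fin.append g h) ↔ i ∈ desSet h := by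
  have key : ∀ j (hj : j < k), Fin.append g h ⟨m + j, by omega⟩ = h ⟨j, hj⟩ := fun j hj =>
    Fin.append_right g h ⟨j, hj⟩
  have idx : m + i - 1 = m + (i - 1) := by omega
  simp only [desSet, Set.mem_ofPred_eq, idx]
  constructor
  · rintro ⟨⟨_, h2⟩, hlt⟩
    rw [key i (by omega), key (i - 1) (by omega)] at hlt
    exact ⟨⟨hi, by omega⟩, hlt⟩
  · rintro ⟨⟨_, h2⟩, hlt⟩
    refine ⟨⟨by omega, by omega⟩, ?_⟩
    rwa [key i h2, key (i - 1) (by omega)]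

theorem monotone_iff_desSet_eq_empty {k : ℕ} {α : Type*} [LinearOrder α] {f : Fin k → α} :
    Monotone f ↔ desSet f = ∅ := by
  rw [Set.eq_empty_iff_forall_notMem]
  constructor
  · rintro hf i ⟨hi, hlt⟩
    exact hlt.not_ge (hf (Fin.mk_le_mk.2 (Nat.sub_le i 1)))
  · intro h
    cases k with
    | zero => exact fun i => i.elim0
    | succ k =>
      refine Fin.monotone_iff_le_succ.2 fun i => ?_
      by_contra! hlt
      exact h (i + 1) ⟨⟨by omega, by omega⟩, hlt⟩

theorem desSet_append_eq_iff {m k : ℕ} {α : Type*} [LinearOrder α] (g : Fin m → α)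
    (h : Fin k → α) {J : Set ℕ} (hJ : ∀ i ∈ J, i < m) :
    (desSet (Fin.append g h) = insert m J ∨ desSet (Fin.append g h) = J)
      ↔ desSet g = J ∧ Monotone h := by
  have hg : ∀ i ∈ desSet g, i < m := fun i hi => hi.1.2
  have hh : ∀ i ∈ desSet h, 1 ≤ i := fun i hi => hi.1.1
  have hl := fun i (hi : i < m) => mem_desSet_append_of_lt g h hi
  have hr := fun i (hi : 1 ≤ i) => mem_desSet_append_add g h hi
  rw [monotone_iff_desSet_eq_empty]
  generalize desSet (Fin.append g h) = D at *
  generalize desSet g = G at *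
  generalize desSet h = H at *
  simp only [Set.ext_iff, Set.mem_insert_iff, Set.mem_empty_iff_false, iff_false]
  constructor
  · intro hD
    refine ⟨fun i => ?_, fun i hi => ?_⟩
    · have := hl i
      have := hg i
      have := hJ i
      rcases hD with hD | hD <;> have := hD i <;> grind
    · have := (hr i (hh i hi)).2 hi
      have := hh i hi
      have := hJ (m + i)
      rcases hD with hD | hD <;> have := hD (m + i) <;> grind
  · rintro ⟨hGJ, hH⟩
    have key : ∀ i, i ≠ m → (i ∈ D ↔ i ∈ J) := by
      intro i hi
      rcases lt_or_gt_of_ne hi with hi | hi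
      · rw [hl i hi, hGJ]
      · obtain ⟨j, rfl⟩ := Nat.exists_eq_add_of_lt hi
        have := hr (j + 1) (by omega)
        have := hH (j + 1)
        have := hJ (m + j + 1)
        grind
    by_cases hm : m ∈ D
    · left
      intro i
      by_cases hi : i = m <;> grind
    · right
      intro i
      by_cases hi : i = m <;> grind

theorem card_filter_desSet_eq {n m : ℕ} {α : Type*} [LinearOrder α] [Fintype α] (hmn : m ≤ n)
    (β : Fin n → α) {J : Set ℕ} (hJ : ∀ i ∈ J, i < m) :
    (Finset.univ.filter (fun f : Fin n → α =>
        (Finset.univ.val.map f : Multiset α) = Finset.univ.val.map β ∧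
          (desSet f = insert m J ∨ desSet f = J))).card
      = (Finset.univ.filter (fun g : Fin m → α =>
        (Finset.univ.val.map g : Multiset α) ≤ Finset.univ.val.map β ∧ desSet g = J)).card := by
  obtain ⟨k, rfl⟩ := Nat.exists_eq_add_of_le hmn
  refine Finset.card_bij (fun f _ => f ∘ Fin.castAdd k) ?_ ?_ ?_
  · intro f hf
    obtain ⟨g, h, rfl⟩ := exists_append_eq f
    simp only [Finset.mem_filter, Finset.mem_univ, true_and,
      desSet_append_eq_iff g h hJ, Multiset.map_univ_append] at hf
    simp only [Finset.mem_filter, Finset.mem_univ, true_and,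
      append_comp_castAdd]
    exact ⟨hf.1 ▸ Multiset.le_add_right _ _, hf.2.1⟩
  · intro f hf f' hf' heq
    obtain ⟨g, h, rfl⟩ := exists_append_eq f
    obtain ⟨g', h', rfl⟩ := exists_append_eq f'
    simp only [Finset.mem_filter, Finset.mem_univ, true_and,
      desSet_append_eq_iff _ _ hJ, Multiset.map_univ_append,
      append_comp_castAdd] at hf hf' heq ⊢
    subst heq
    rw [hf.2.2.eq_of_map_univ_eq hf'.2.2 (add_left_cancel (hf.1.trans hf'.1.symm))]
  · intro g hg
    simp only [Finset.mem_filter, Finset.mem_univ, true_and] at hg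
    obtain ⟨t, ht⟩ := Multiset.le_iff_exists_add.1 hg.1
    have hc : t.card = k := by
      have := congrArg Multiset.card ht
      simpa using this.symm
    obtain ⟨h, hmono, rfl⟩ := t.exists_monotone_map_univ_eq hc
    refine ⟨Fin.append g h, ?_, append_comp_castAdd g h⟩
    simp only [Finset.mem_filter, Finset.mem_univ, true_and, desSet_append_eq_iff _ _ hJ,
      Multiset.map_univ_append]
    exact ⟨ht.symm, hg.2, hmono⟩

theorem sum_powersetCard_card_filter {m : ℕ} {α : Type*} [Fintype α] [DecidableEq α]
    (s : Multiset α) (p : (Fin m → α) → Prop) [DecidablePred p] :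
    ∑ X ∈ (Multiset.powersetCard m s).toFinset,
        (Finset.univ.filter (fun g : Fin m → α => Finset.univ.val.map g = X ∧ p g)).card
      = (Finset.univ.filter (fun g : Fin m → α => Finset.univ.val.map g ≤ s ∧ p g)).card := by
  rw [Finset.card_eq_sum_card_fiberwise (f := fun g : Fin m → α => Finset.univ.val.map g)
    (t := (Multiset.powersetCard m s).toFinset)]
  · refine Finset.sum_congr rfl fun X hX => ?_
    rw [Finset.filter_filter]
    congr 1
    ext g
    simp only [Multiset.mem_toFinset, Multiset.mem_powersetCard, Finset.mem_filter] at hX ⊢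
    grind
  · intro g hg
    simpa [Multiset.mem_powersetCard] using (Finset.mem_filter.1 hg).2.1

theorem card_filter_isPF_eq_sum {n : ℕ} (p : (Fin n → Fin n) → Prop) [DecidablePred p] :
    (Finset.univ.filter (fun f : Fin n → Fin n => IsPF f ∧ p f)).card
      = ∑ β ∈ Finset.univ.filter (fun β : Fin n → Fin n => IsPF β ∧ Monotone β),
        (Finset.univ.filter (fun f : Fin n → Fin n =>
          (Finset.univ.val.map f : Multiset (Fin n)) = Finset.univ.val.map β ∧ p f)).card := by
  rw [Finset.card_eq_sum_card_fiberwise (f := fun f : Fin n → Fin n => f ∘ Tuple.sort f)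
    (t := Finset.univ.filter (fun β : Fin n → Fin n => IsPF β ∧ Monotone β))]
  · refine Finset.sum_congr rfl fun β hβ => ?_
    rw [Finset.filter_filter]
    congr 1
    ext f
    simp only [Finset.mem_filter, Finset.mem_univ, true_and] at hβ ⊢
    rw [← comp_sort_eq_iff hβ.2]
    constructor
    · rintro ⟨⟨_, hp⟩, h⟩
      exact ⟨h, hp⟩
    · rintro ⟨h, hp⟩
      exact ⟨⟨(isPF_comp_perm_iff _).1 (h ▸ hβ.1), hp⟩, h⟩
  · intro f hf
    have hf := (Finset.mem_filter.1 hf).2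
    simpa using ⟨hf.1.comp_perm _, Tuple.monotone_sort f⟩

/-- The recursion of Theorem 3.8: for nonempty `I ⊆ [n-1]` with `m = max I` and
`I⁻ = I \ {m}`,
`d(I;n) = Σ_{β ∈ PF↑_n} ( Σ_{X size-m submultiset of β} d_X(I⁻; m) ) − d(I⁻;n)`,
where `d_X(I⁻;m)` counts the words of length `m` whose multiset of letters is `X` and
whose descent set is exactly `I⁻`. -/
theorem stmt5 (n : ℕ) (hn : 1 ≤ n) (I : Finset ℕ) (hne : I.Nonempty)
    (hI : I ⊆ Finset.Icc 1 (n - 1)) :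
    (dCount n I : ℤ)
      = (∑ β ∈ Finset.univ.filter (fun β : Fin n → Fin n => IsPF β ∧ Monotone β),
          ∑ X ∈ (Multiset.powersetCard (I.max' hne) (Finset.univ.val.map β)).toFinset,
            ((Finset.univ.filter (fun g : Fin (I.max' hne) → Fin n =>
                Finset.univ.val.map g = X ∧ desSet g = ↑(I.erase (I.max' hne)))).card : ℤ))
        - (dCount n (I.erase (I.max' hne)) : ℤ) := by
  set m := I.max' hne with hm
  have hmI : m ∈ I := I.max'_mem hne
  have hmn : m ≤ n := by
    have := Finset.mem_Icc.1 (hI hmI)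
    omega
  have hJ : ∀ i ∈ (↑(I.erase m) : Set ℕ), i < m := fun i hi =>
    lt_of_le_of_ne (I.le_max' i (Finset.mem_of_mem_erase hi)) (Finset.ne_of_mem_erase hi)
  have hins : insert m (↑(I.erase m) : Set ℕ) = ↑I := by
    rw [← Finset.coe_insert, Finset.insert_erase hmI]
  have hne' : (↑I : Set ℕ) ≠ ↑(I.erase m) := fun h =>
    Finset.notMem_erase m I (Finset.coe_injective h ▸ hmI)
  have hsum : dCount n I + dCount n (I.erase m)
      = (Finset.univ.filter (fun f : Fin n → Fin n =>
        IsPF f ∧ (desSet f = insert m ↑(I.erase m) ∨ desSet f = ↑(I.erase m)))).card := by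
    rw [dCount, dCount, ← Finset.card_union_of_disjoint, ← Finset.filter_or, hins]
    · simp only [and_or_left]
    · refine Finset.disjoint_filter.2 fun f _ h h' => hne' (h.2.symm.trans h'.2)
  rw [eq_sub_iff_add_eq]
  norm_cast
  rw [hsum, card_filter_isPF_eq_sum]
  refine Finset.sum_congr rfl fun β _ => ?_
  rw [card_filter_desSet_eq hmn β hJ, sum_powersetCard_card_filter]
end

section
/- For every n ≥ 1 and every i ∈ [n], the number of peakless-tieless parking functions of length n whose last entry equals i is the Catalan triangle entry C_{n,i}; that is, |PTPF_n(i)| = C_{n,i} where PTPF_n(i) = {α = (a_1,…,a_n) ∈ PTPF_n : a_n = i}. -/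
open scoped Classical

/-- The (1-indexed) peak set of a tuple `a_1, …, a_k`: the indices `i` with
`2 ≤ i ≤ k-1` and `a_{i-1} < a_i > a_{i+1}`.  (Here `a_i = f ⟨i-1, _⟩`.) -/
def peakSet {k : ℕ} {α : Type*} [LT α] (f : Fin k → α) : Set ℕ :=
  {i | ∃ h : 2 ≤ i ∧ i < k,
    f ⟨i - 2, (Nat.sub_le i 2).trans_lt h.2⟩ < f ⟨i - 1, (Nat.sub_le i 1).trans_lt h.2⟩ ∧
    f ⟨i, h.2⟩ < f ⟨i - 1, (Nat.sub_le i 1).trans_lt h.2⟩}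

/-- The (1-indexed) tie set of a tuple `a_1, …, a_k`: the indices `i ∈ [k-1]`
with `a_i = a_{i+1}`.  (Here `a_i = f ⟨i-1, _⟩`.) -/
def tieSet {k : ℕ} {α : Type*} (f : Fin k → α) : Set ℕ :=
  {i | ∃ h : 1 ≤ i ∧ i < k, f ⟨i - 1, (Nat.sub_le i 1).trans_lt h.2⟩ = f ⟨i, h.2⟩}

/-- The Catalan triangle: `catTri 1 1 = 1`, and
`catTri (n+1) i = Σ_{j=1}^{i} catTri n j` for `1 ≤ i ≤ n+1`, with
`catTri n j = 0` whenever `j < 1` or `j > n`. -/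
def catTri : ℕ → ℕ → ℕ
  | 0, _ => 0
  | 1, i => if i = 1 then 1 else 0
  | n + 2, i =>
      if 1 ≤ i ∧ i ≤ n + 2 then ∑ j ∈ Finset.Icc 1 i, catTri (n + 1) j else 0

open Finset

/-- Pairs `(A, B)` of subsets of `{0, …, n - 1}` with `0 ∈ B \ A` and `n + h` elements in total,
at least `k` of which are smaller than `k`, for every `k ≤ n`. -/
def valleyPairs (n h : ℕ) : Finset (Finset ℕ × Finset ℕ) :=
  ((range n).powerset ×ˢ (range n).powerset).filter fun P =>
    0 ∉ P.1 ∧ 0 ∈ P.2 ∧ (∀ k ≤ n, k ≤ #{a ∈ P.1 | a < k} + #{b ∈ P.2 | b < k}) ∧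
      #P.1 + #P.2 = n + h

/-- The pairs in `valleyPairs n h` whose second component has maximum `i`. -/
def valleyPairsMax (n h i : ℕ) : Finset (Finset ℕ × Finset ℕ) :=
  {P ∈ valleyPairs n h | P.2.sup id = i}

theorem mem_valleyPairs {n h : ℕ} {A B : Finset ℕ} :
    (A, B) ∈ valleyPairs n h ↔ A ⊆ range n ∧ B ⊆ range n ∧ 0 ∉ A ∧ 0 ∈ B ∧
      (∀ k ≤ n, k ≤ #{a ∈ A | a < k} + #{b ∈ B | b < k}) ∧ #A + #B = n + h := by
  simp [valleyPairs, and_assoc]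

theorem filter_union_lt_of_le {n k : ℕ} (hk : k ≤ n) (A : Finset ℕ) {s : Finset ℕ}
    (hs : s ⊆ {n}) : {a ∈ A ∪ s | a < k} = {a ∈ A | a < k} := by
  ext a
  have := @hs a
  simp only [mem_filter, mem_union, mem_singleton] at *
  grind

theorem card_union_of_subset_range {n : ℕ} {A s : Finset ℕ} (hA : A ⊆ range n) (hs : s ⊆ {n}) :
    #(A ∪ s) = #A + #s := by
  refine card_union_of_disjoint (Finset.disjoint_left.2 fun a ha has => ?_)
  have h1 := mem_range.1 (hA ha)
  have h2 := mem_singleton.1 (hs has)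
  omega

theorem union_mem_valleyPairs_succ {n h h₀ : ℕ} (hn : 1 ≤ n) {A B s t : Finset ℕ}
    (hA : A ⊆ range n) (hB : B ⊆ range n) (hs : s ⊆ {n}) (ht : t ⊆ {n})
    (hh : h₀ + #s + #t = h + 1) :
    (A ∪ s, B ∪ t) ∈ valleyPairs (n + 1) h ↔ (A, B) ∈ valleyPairs n h₀ := by
  have zero_notMem : ∀ u : Finset ℕ, u ⊆ {n} → 0 ∉ u := fun u hu h0 => by
    have := mem_singleton.1 (hu h0)
    omega
  have sub : ∀ C u : Finset ℕ, C ⊆ range n → u ⊆ {n} → C ∪ u ⊆ range (n + 1) :=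
    fun C u hC hu => union_subset (hC.trans (range_mono n.le_succ))
      (hu.trans (by simp))
  have full : ∀ C u : Finset ℕ, C ⊆ range n → u ⊆ {n} →
      {a ∈ C ∪ u | a < n + 1} = C ∪ u := fun C u hC hu =>
    filter_true_of_mem fun a ha => mem_range.1 (sub C u hC hu ha)
  simp only [mem_valleyPairs, hA, hB, sub A s hA hs, sub B t hB ht, true_and, mem_union,
    zero_notMem s hs, zero_notMem t ht, or_false]
  rw [card_union_of_subset_range hA hs, card_union_of_subset_range hB ht]
  refine and_congr_right fun _ => and_congr_right fun _ => ?_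
  constructor
  · rintro ⟨h1, h2⟩
    refine ⟨fun k hk => ?_, by omega⟩
    have := h1 k (by omega)
    rwa [filter_union_lt_of_le hk A hs, filter_union_lt_of_le hk B ht] at this
  · rintro ⟨h1, h2⟩
    refine ⟨fun k hk => ?_, by omega⟩
    obtain hk | rfl := Nat.le_succ_iff.1 hk
    · rw [filter_union_lt_of_le hk A hs, filter_union_lt_of_le hk B ht]
      exact h1 k hk
    · rw [full A s hA hs, full B t hB ht, card_union_of_subset_range hA hs,
        card_union_of_subset_range hB ht]
      omega

theorem card_filter_inter_eq {n h h₀ : ℕ} (hn : 1 ≤ n) {s t : Finset ℕ}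
    (hs : s ⊆ {n}) (ht : t ⊆ {n}) (hh : h₀ + #s + #t = h + 1) (p : Finset ℕ → Prop)
    [DecidablePred p] :
    #{P ∈ valleyPairs (n + 1) h | P.1 ∩ {n} = s ∧ P.2 ∩ {n} = t ∧ p (P.2.erase n)} =
      #{P ∈ valleyPairs n h₀ | p P.2} := by
  have split : ∀ C : Finset ℕ, C.erase n ∪ C ∩ {n} = C := fun C => by
    ext a
    by_cases ha : a = n <;> simp [ha]
  have inter : ∀ C u : Finset ℕ, C ⊆ range n → u ⊆ {n} → (C ∪ u) ∩ {n} = u := fun C u hC hu => by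
    ext a
    have h1 := @hC a
    have h2 := @hu a
    simp only [mem_range, mem_singleton, mem_inter, mem_union] at *
    grind
  have erase : ∀ C u : Finset ℕ, C ⊆ range n → u ⊆ {n} → (C ∪ u).erase n = C := fun C u hC hu => by
    ext a
    have h1 := @hC a
    have h2 := @hu a
    simp only [mem_range, mem_singleton, mem_erase, mem_union] at *
    grind
  have sub : ∀ C : Finset ℕ, C ⊆ range (n + 1) → C.erase n ⊆ range n := fun C hC a ha => by
    have h1 := @hC a
    simp only [mem_range, mem_erase] at *
    grind
  refine card_bij' (fun P _ => (P.1.erase n, P.2.erase n)) (fun P _ => (P.1 ∪ s, P.2 ∪ t))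
    ?_ ?_ ?_ ?_
  · rintro ⟨A, B⟩ hP
    simp only [mem_filter] at hP ⊢
    obtain ⟨hP, rfl, rfl, hp⟩ := hP
    have hm := mem_valleyPairs.1 hP
    refine ⟨?_, hp⟩
    rw [← union_mem_valleyPairs_succ hn (sub A hm.1) (sub B hm.2.1) hs ht hh, split, split]
    exact hP
  · rintro ⟨A, B⟩ hP
    simp only [mem_filter] at hP ⊢
    have hm := mem_valleyPairs.1 hP.1
    rw [union_mem_valleyPairs_succ hn hm.1 hm.2.1 hs ht hh, inter A s hm.1 hs,
      inter B t hm.2.1 ht, erase B t hm.2.1 ht]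
    exact ⟨hP.1, rfl, rfl, hP.2⟩
  · rintro ⟨A, B⟩ hP
    simp only [mem_filter] at hP ⊢
    obtain ⟨hP, rfl, rfl, hp⟩ := hP
    rw [split, split]
  · rintro ⟨A, B⟩ hP
    simp only [mem_filter] at hP ⊢
    have hm := mem_valleyPairs.1 hP.1
    rw [erase A s hm.1 hs, erase B t hm.2.1 ht]

theorem sup_lt_of_mem_valleyPairs {n h : ℕ} {P : Finset ℕ × Finset ℕ}
    (hP : P ∈ valleyPairs n h) : P.2.sup id < n := by
  obtain ⟨A, B⟩ := P
  have hm := mem_valleyPairs.1 hP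
  have h0 := mem_range.1 (hm.2.1 hm.2.2.2.1)
  exact (Finset.sup_lt_iff h0).2 fun b hb => mem_range.1 (hm.2.1 hb)

theorem card_valleyPairs_eq_sum (n h : ℕ) :
    #(valleyPairs n h) = ∑ i ∈ range n, #(valleyPairsMax n h i) :=
  card_eq_sum_card_fiberwise fun _ hP => mem_coe.2 (mem_range.2 (sup_lt_of_mem_valleyPairs hP))

theorem inter_singleton_eq_empty_or {α : Type*} [DecidableEq α] (C : Finset α) (n : α) :
    C ∩ {n} = ∅ ∧ n ∉ C ∨ C ∩ {n} = {n} ∧ n ∈ C := by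
  by_cases hn : n ∈ C <;> simp [hn]

theorem card_valleyPairsMax_succ_of_lt {n h i : ℕ} (hi : i < n) :
    #(valleyPairsMax (n + 1) h i) = #(valleyPairsMax n h i) + #(valleyPairsMax n (h + 1) i) := by
  have hn : 1 ≤ n := by omega
  unfold valleyPairsMax
  rw [← card_filter_inter_eq (h := h) hn (subset_refl {n}) (empty_subset _) (by simp)
      (fun C => C.sup id = i),
    ← card_filter_inter_eq (h := h) hn (empty_subset _) (empty_subset _) (by simp)
      (fun C => C.sup id = i), ← card_union_of_disjoint]
  · congr 1
    ext P
    simp only [mem_union, mem_filter, ← and_or_left]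
    refine and_congr_right fun _ => ?_
    rcases inter_singleton_eq_empty_or P.2 n with ⟨h2, h2'⟩ | ⟨h2, h2'⟩
    · rcases inter_singleton_eq_empty_or P.1 n with ⟨h1, h1'⟩ | ⟨h1, h1'⟩ <;>
        simp [h1, h2, erase_eq_of_notMem h2', (singleton_ne_empty n).symm]
    · have : n ≤ P.2.sup id := le_sup (f := id) h2'
      simp only [h2, singleton_ne_empty, false_and, and_false, or_false, iff_false]
      omega
  · rw [disjoint_filter]
    rintro P - ⟨h1, -⟩ ⟨h2, -⟩
    exact singleton_ne_empty n (h1.symm.trans h2)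

theorem sup_eq_iff_mem_of_mem_valleyPairs_succ {n h : ℕ} (hn : 1 ≤ n) {P : Finset ℕ × Finset ℕ}
    (hP : P ∈ valleyPairs (n + 1) h) : P.2.sup id = n ↔ n ∈ P.2 := by
  refine ⟨fun hs => ?_, fun hm => ?_⟩
  · by_contra hm
    have : P.2.sup id < n := (Finset.sup_lt_iff hn).2 fun b hb => by
      have h1 := mem_range.1 ((mem_valleyPairs.1 hP).2.1 hb)
      have h2 : b ≠ n := fun e => hm (e ▸ hb)
      simp only [id]
      omega
    omega
  · have := sup_lt_of_mem_valleyPairs hP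
    have : n ≤ P.2.sup id := le_sup (f := id) hm
    omega

theorem card_valleyPairsMax_succ_self_eq_add {n h : ℕ} (hn : 1 ≤ n) :
    #(valleyPairsMax (n + 1) h n) = #(valleyPairs n h) +
      #{P ∈ valleyPairs (n + 1) h | P.1 ∩ {n} = {n} ∧ P.2 ∩ {n} = {n}} := by
  have e := card_filter_inter_eq (h := h) (h₀ := h) hn (empty_subset _) (subset_refl {n})
    (by simp) (fun _ => True)
  simp only [and_true, filter_true] at e
  rw [← e, ← card_union_of_disjoint]
  · congr 1
    ext P
    simp only [valleyPairsMax, mem_union, mem_filter, ← and_or_left]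
    refine and_congr_right fun hP => ?_
    rw [sup_eq_iff_mem_of_mem_valleyPairs_succ hn hP]
    rcases inter_singleton_eq_empty_or P.2 n with ⟨h2, h2'⟩ | ⟨h2, h2'⟩ <;>
    rcases inter_singleton_eq_empty_or P.1 n with ⟨h1, h1'⟩ | ⟨h1, h1'⟩ <;>
        simp [h1, h2, h2', (singleton_ne_empty n).symm]
  · rw [disjoint_filter]
    rintro P - ⟨h1, -⟩ ⟨h2, -⟩
    exact singleton_ne_empty n (h2.symm.trans h1)

theorem card_valleyPairsMax_succ_self_succ {n h : ℕ} (hn : 1 ≤ n) :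
    #(valleyPairsMax (n + 1) (h + 1) n) = #(valleyPairs n (h + 1)) + #(valleyPairs n h) := by
  have e := card_filter_inter_eq (h := h + 1) (h₀ := h) hn (subset_refl {n}) (subset_refl {n})
    (by simp) (fun _ => True)
  simp only [and_true, filter_true] at e
  rw [card_valleyPairsMax_succ_self_eq_add hn, e]

theorem card_valleyPairsMax_succ_self_zero {n : ℕ} (hn : 1 ≤ n) :
    #(valleyPairsMax (n + 1) 0 n) = #(valleyPairs n 0) := by
  rw [card_valleyPairsMax_succ_self_eq_add hn, Nat.add_eq_left, card_eq_zero, filter_eq_empty_iff]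
  rintro ⟨A, B⟩ hP ⟨hA, hB⟩
  obtain ⟨sA, sB, -, -, hk, hc⟩ := mem_valleyPairs.1 hP
  have lt : ∀ C : Finset ℕ, C ∩ {n} = {n} → #{a ∈ C | a < n} < #C := fun C hC => by
    have hn : n ∈ C := (mem_inter.1 (hC ▸ mem_singleton_self n)).1
    exact card_lt_card (filter_ssubset.2 ⟨n, hn, lt_irrefl n⟩)
  have h1 := lt A hA
  have h2 := lt B hB
  have h3 := hk n n.le_succ
  omega

theorem card_valleyPairs_succ_succ {n h : ℕ} (hn : 1 ≤ n) :
    #(valleyPairs (n + 1) (h + 1)) =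
      #(valleyPairs n (h + 2)) + 2 * #(valleyPairs n (h + 1)) + #(valleyPairs n h) := by
  rw [card_valleyPairs_eq_sum (n + 1), sum_range_succ, card_valleyPairsMax_succ_self_succ hn,
    sum_congr rfl fun i hi => card_valleyPairsMax_succ_of_lt (mem_range.1 hi), sum_add_distrib,
    ← card_valleyPairs_eq_sum, ← card_valleyPairs_eq_sum]
  ring

theorem card_valleyPairs_succ_zero {n : ℕ} (hn : 1 ≤ n) :
    #(valleyPairs (n + 1) 0) = #(valleyPairs n 1) + 2 * #(valleyPairs n 0) := by
  rw [card_valleyPairs_eq_sum (n + 1), sum_range_succ, card_valleyPairsMax_succ_self_zero hn,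
    sum_congr rfl fun i hi => card_valleyPairsMax_succ_of_lt (mem_range.1 hi), sum_add_distrib,
    ← card_valleyPairs_eq_sum, ← card_valleyPairs_eq_sum]
  ring

theorem card_valleyPairs_one (h : ℕ) : #(valleyPairs 1 h) = if h = 0 then 1 else 0 := by
  have key : ∀ P ∈ valleyPairs 1 h, P = (∅, {0}) ∧ h = 0 := by
    rintro ⟨A, B⟩ hP
    obtain ⟨sA, sB, hA, hB, -, hc⟩ := mem_valleyPairs.1 hP
    rw [range_one, subset_singleton_iff] at sA sB
    rcases sA with rfl | rfl <;> rcases sB with rfl | rfl <;> simp_all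
  split_ifs with h0
  · subst h0
    refine card_eq_one.2 ⟨(∅, {0}), eq_singleton_iff_unique_mem.2 ⟨?_, fun P hP => (key P hP).1⟩⟩
    refine mem_valleyPairs.2 ⟨by simp, by simp, by simp, by simp, fun k hk => ?_, by simp⟩
    interval_cases k
    · exact Nat.zero_le _
    · decide
  · exact card_eq_zero.2 (eq_empty_of_forall_notMem fun P hP => h0 (key P hP).2)

theorem card_valleyPairsMax_one (h : ℕ) :
    #(valleyPairsMax 1 h 0) = if h = 0 then 1 else 0 := by
  rw [← card_valleyPairs_one, card_valleyPairs_eq_sum, sum_range_one]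

theorem card_valleyPairsMax_zero_of_pos {n : ℕ} (hn : 1 ≤ n) (h : ℕ) :
    #(valleyPairsMax n (h + 1) 0) = 0 := by
  induction n, hn using Nat.le_induction generalizing h with
  | base => simp [card_valleyPairsMax_one]
  | succ n hn ih => rw [card_valleyPairsMax_succ_of_lt hn, ih, ih]

theorem card_valleyPairsMax_succ_succ {n i : ℕ} (hi : i + 2 ≤ n) (h : ℕ) :
    #(valleyPairsMax n (h + 1) (i + 1)) = #(valleyPairsMax (n + 1) h i) := by
  induction n, hi using Nat.le_induction generalizing h with
  | base =>
    have h1 := @card_valleyPairsMax_succ_of_lt (i + 2) h i (by omega)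
    have h2 := @card_valleyPairsMax_succ_of_lt (i + 1) h i (by omega)
    have h3 := @card_valleyPairsMax_succ_of_lt (i + 1) (h + 1) i (by omega)
    rw [h1, h2, h3, card_valleyPairsMax_succ_self_succ (by omega)]
    obtain _ | i := i
    · simp [card_valleyPairsMax_one, card_valleyPairs_one]
    · obtain _ | h := h
      · simp only [card_valleyPairsMax_succ_self_succ i.succ_pos,
          card_valleyPairsMax_succ_self_zero i.succ_pos, card_valleyPairs_succ_succ i.succ_pos,
          card_valleyPairs_succ_zero i.succ_pos]
        ring
      · simp only [card_valleyPairsMax_succ_self_succ i.succ_pos,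
          card_valleyPairs_succ_succ i.succ_pos]
        ring
  | succ n hn ih =>
    rw [card_valleyPairsMax_succ_of_lt (by omega), ih, ih,
      ← card_valleyPairsMax_succ_of_lt (by omega)]

theorem card_valleyPairsMax_succ_self_eq {n : ℕ} (hn : 1 ≤ n) :
    #(valleyPairsMax (n + 1) 0 n) = #(valleyPairsMax (n + 1) 0 (n - 1)) := by
  rw [card_valleyPairsMax_succ_self_zero hn, card_valleyPairsMax_succ_of_lt (by omega)]
  obtain ⟨_ | n, rfl⟩ := Nat.exists_eq_add_of_le' hn
  · simp [card_valleyPairsMax_one, card_valleyPairs_one]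
  · rw [card_valleyPairs_succ_zero n.succ_pos, Nat.add_sub_cancel,
      card_valleyPairsMax_succ_self_zero n.succ_pos, card_valleyPairsMax_succ_self_succ n.succ_pos]
    ring

theorem catTri_of_lt {n i : ℕ} (hi : n < i) : catTri n i = 0 := by
  match n with
  | 0 => rfl
  | 1 => simp [catTri]; omega
  | n + 2 => simp [catTri]; omega

theorem card_valleyPairsMax_eq_catTri {n i : ℕ} (hi : i < n) :
    #(valleyPairsMax n 0 i) = catTri n (i + 1) := by
  obtain _ | n := n
  · omega
  induction n generalizing i with
  | zero =>
    obtain rfl : i = 0 := by omega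
    simp [card_valleyPairsMax_one, catTri]
  | succ n ihn =>
    have hcat : ∀ j < n + 2, catTri (n + 2) (j + 1) =
        ∑ l ∈ Finset.Icc 1 (j + 1), catTri (n + 1) l := fun j hj =>
      if_pos ⟨by omega, by omega⟩
    induction i with
    | zero =>
      rw [hcat 0 hi, card_valleyPairsMax_succ_of_lt (by omega),
        card_valleyPairsMax_zero_of_pos (by omega), ihn (by omega)]
      simp
    | succ i ihi =>
      rw [hcat (i + 1) hi, sum_Icc_succ_top (by omega), ← hcat i (by omega), ← ihi (by omega)]
      obtain hlt | heq := lt_or_eq_of_le (show i + 1 ≤ n + 1 by omega)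
      · rw [card_valleyPairsMax_succ_of_lt hlt, card_valleyPairsMax_succ_succ (by omega),
          ihn hlt, add_comm]
      · obtain rfl : i = n := by omega
        rw [catTri_of_lt (by omega), card_valleyPairsMax_succ_self_eq (by omega)]
        rfl

/-- The values of `l` before, and from, the first occurrence of `0`. -/
def valleySplit (l : List ℕ) : Finset ℕ × Finset ℕ :=
  ((l.take (l.idxOf 0)).toFinset, (l.drop (l.idxOf 0)).toFinset)

/-- A word that strictly decreases before its first `0` and strictly increases from there on. -/
structure IsValley (l : List ℕ) : Prop where
  zero_mem : 0 ∈ l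
  sortedGT_take : (l.take (l.idxOf 0)).SortedGT
  sortedLT_drop : (l.drop (l.idxOf 0)).SortedLT

theorem List.Nodup.card_filter_toFinset {l : List ℕ} (hl : l.Nodup) (k : ℕ) :
    #{a ∈ l.toFinset | a < k} = l.countP (· < k) := by
  rw [List.countP_eq_length_filter, ← List.toFinset_card_of_nodup (hl.filter _),
    List.toFinset_filter]
  simp only [decide_eq_true_eq]

theorem List.SortedLT.sup_toFinset {l : List ℕ} (hl : l.SortedLT) (hne : l ≠ []) :
    l.toFinset.sup id = l.getLast hne := by
  refine le_antisymm (Finset.sup_le fun a ha => ?_)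
    (le_sup (f := id) (List.mem_toFinset.2 (List.getLast_mem hne)))
  exact hl.sortedLE.pairwise.rel_getLast (List.mem_toFinset.1 ha)

theorem IsValley.valleySplit_mem_iff {l : List ℕ} (hl : IsValley l) {n i : ℕ} :
    valleySplit l ∈ valleyPairsMax n 0 i ↔ l.length = n ∧ (∀ x ∈ l, x < n) ∧
      (∀ k ≤ n, k ≤ l.countP (· < k)) ∧ l.getLast? = some i := by
  have hp : l.idxOf 0 < l.length := List.idxOf_lt_length_iff.2 hl.zero_mem
  have hne : l.drop (l.idxOf 0) ≠ [] := by simpa using hp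
  have h0A : 0 ∉ l.take (l.idxOf 0) := by
    rw [List.mem_take_iff_idxOf_lt hl.zero_mem]
    exact lt_irrefl _
  have hmem : ∀ x, x ∈ l ↔ x ∈ l.take (l.idxOf 0) ∨ x ∈ l.drop (l.idxOf 0) := fun x => by
    rw [← List.mem_append, List.take_append_drop]
  have h0B : 0 ∈ l.drop (l.idxOf 0) := ((hmem 0).1 hl.zero_mem).resolve_left h0A
  have hcount : ∀ k, l.countP (· < k) =
      (l.take (l.idxOf 0)).countP (· < k) + (l.drop (l.idxOf 0)).countP (· < k) := fun k => by
    rw [← List.countP_append, List.take_append_drop]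
  have hlen : (l.take (l.idxOf 0)).length + (l.drop (l.idxOf 0)).length = l.length := by
    rw [← List.length_append, List.take_append_drop]
  have hlast : l.getLast? = some i ↔ (l.drop (l.idxOf 0)).getLast hne = i := by
    rw [List.getLast_drop, List.getLast?_eq_some_getLast (List.ne_nil_of_mem hl.zero_mem),
      Option.some_inj]
  have hA := hl.sortedGT_take.nodup
  have hB := hl.sortedLT_drop.nodup
  simp only [valleyPairsMax, valleySplit, mem_filter, mem_valleyPairs,
    hA.card_filter_toFinset, hB.card_filter_toFinset, List.toFinset_card_of_nodup hA,
    List.toFinset_card_of_nodup hB, hl.sortedLT_drop.sup_toFinset hne, hcount, hlen, hlast,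
    List.mem_toFinset, h0A, h0B, hmem, subset_iff, mem_range, or_imp, forall_and]
  tauto

theorem IsValley.ext {l l' : List ℕ} (hl : IsValley l) (hl' : IsValley l')
    (h : valleySplit l = valleySplit l') : l = l' := by
  simp only [valleySplit, Prod.mk.injEq] at h
  rw [← List.take_append_drop (l.idxOf 0) l, ← List.take_append_drop (l'.idxOf 0) l']
  congr 1
  · exact (List.perm_of_nodup_nodup_toFinset_eq hl.sortedGT_take.nodup hl'.sortedGT_take.nodup
      h.1).eq_of_sortedGE hl.sortedGT_take.sortedGE hl'.sortedGT_take.sortedGE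
  · exact (List.perm_of_nodup_nodup_toFinset_eq hl.sortedLT_drop.nodup hl'.sortedLT_drop.nodup
      h.2).eq_of_sortedLE hl.sortedLT_drop.sortedLE hl'.sortedLT_drop.sortedLE

theorem exists_isValley_valleySplit_eq {A B : Finset ℕ} (hA : 0 ∉ A) (hB : 0 ∈ B) :
    ∃ l, IsValley l ∧ valleySplit l = (A, B) := by
  obtain ⟨t, ht⟩ : ∃ t, B.sort (· ≤ ·) = 0 :: t := by
    refine ⟨(B.erase 0).sort, ?_⟩
    conv_lhs => rw [← insert_erase hB]
    exact sort_insert _ (fun b _ => Nat.zero_le b) (notMem_erase 0 B)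
  have hidx : (A.sort (· ≥ ·) ++ B.sort).idxOf 0 = (A.sort (· ≥ ·)).length := by
    rw [List.idxOf_append_of_notMem (by simpa using hA), ht, List.idxOf_cons_self, add_zero]
  refine ⟨A.sort (· ≥ ·) ++ B.sort, ⟨by simp [hB], ?_, ?_⟩, ?_⟩
  · rw [hidx, List.take_left]
    exact sortedGT_sort A
  · rw [hidx, List.drop_left]
    exact sortedLT_sort B
  · rw [valleySplit, hidx, List.take_left, List.drop_left, sort_toFinset, sort_toFinset]

/-- The word of values of a function `Fin n → Fin n`. -/
def valueWord {n : ℕ} (f : Fin n → Fin n) : List ℕ := List.ofFn fun j => (f j : ℕ)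

theorem countP_valueWord {n : ℕ} (f : Fin n → Fin n) (k : ℕ) :
    (valueWord f).countP (· < k) = #{j | (f j : ℕ) < k} := by
  rw [valueWord, ← Multiset.coe_countP, ← Fin.univ_val_map, Multiset.countP_map]
  rfl

theorem isPF_iff_forall_le_card {n : ℕ} (f : Fin n → Fin n) :
    IsPF f ↔ ∀ k ≤ n, k ≤ #{j | (f j : ℕ) < k} := by
  constructor
  · rintro ⟨σ, -, hσ⟩ k hk
    calc k = #(univ : Finset (Fin k)) := by simp
      _ ≤ #{j | (f j : ℕ) < k} := card_le_card_of_injOn (fun i => σ (Fin.castLE hk i))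
          (fun i _ => by
            have := hσ (Fin.castLE hk i)
            simpa using this.trans_lt i.isLt)
          (fun i _ j _ hij => by simpa using hij)
  · intro h
    refine ⟨Tuple.sort f, Tuple.monotone_sort f, fun i => ?_⟩
    by_contra! hi
    have hcard : #{j | (f j : ℕ) < i + 1} ≤ #(range i) := by
      refine card_le_card_of_injOn (fun j => ((Tuple.sort f).symm j : ℕ)) (fun j hj => ?_)
        (fun a _ b _ hab => by simpa [Fin.val_inj] using hab)
      simp only [coe_filter, mem_univ, true_and, Set.mem_ofPred_eq] at hj
      by_contra hlt
      have hle : i ≤ (Tuple.sort f).symm j := by simpa using hlt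
      have := Tuple.monotone_sort f hle
      simp only [Function.comp_apply, Equiv.apply_symm_apply, Fin.le_def] at this
      omega
    have := h (i + 1) i.isLt
    simp only [card_range] at hcard
    omega

theorem peakSet_eq_empty_iff {n : ℕ} (f : Fin n → Fin n) :
    peakSet f = ∅ ↔ ∀ j (h : j + 2 < (valueWord f).length),
      (valueWord f)[j] < (valueWord f)[j + 1] → (valueWord f)[j + 1] ≤ (valueWord f)[j + 2] := by
  simp only [valueWord, List.length_ofFn, List.getElem_ofFn, Fin.val_fin_lt, Fin.val_fin_le]
  refine ⟨fun hf j h h1 => ?_, fun hf => Set.eq_empty_of_forall_notMem ?_⟩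
  · by_contra! h2
    exact Set.notMem_empty (j + 2) (hf ▸ ⟨⟨by omega, h⟩, h1, h2⟩)
  · rintro j ⟨⟨hj, hn⟩, h1, h2⟩
    obtain ⟨j, rfl⟩ := Nat.exists_eq_add_of_le' hj
    exact (hf j hn h1).not_gt h2

theorem tieSet_eq_empty_iff {n : ℕ} (f : Fin n → Fin n) :
    tieSet f = ∅ ↔ ∀ j (h : j + 1 < (valueWord f).length),
      (valueWord f)[j] ≠ (valueWord f)[j + 1] := by
  simp only [valueWord, List.length_ofFn, List.getElem_ofFn, ne_eq, Fin.val_inj]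
  refine ⟨fun hf j h h1 => ?_, fun hf => Set.eq_empty_of_forall_notMem ?_⟩
  · exact Set.notMem_empty (j + 1) (hf ▸ ⟨⟨by omega, h⟩, h1⟩)
  · rintro j ⟨⟨hj, hn⟩, h1⟩
    obtain ⟨j, rfl⟩ := Nat.exists_eq_add_of_le' hj
    exact hf j hn h1

theorem isValley_iff {l : List ℕ} (hl : 0 ∈ l) :
    IsValley l ↔
      (∀ j (h : j + 2 < l.length), l[j] < l[j + 1] → l[j + 1] ≤ l[j + 2]) ∧
      (∀ j (h : j + 1 < l.length), l[j] ≠ l[j + 1]) := by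
  have hp : l.idxOf 0 < l.length := List.idxOf_lt_length_iff.2 hl
  have hp0 : l[l.idxOf 0] = 0 := List.getElem_idxOf hp
  have hpos : ∀ j (h : j < l.idxOf 0), l[j] ≠ 0 := fun j h => by
    simpa using List.not_of_lt_findIdx h
  obtain ⟨p, hpd⟩ : ∃ p, l.idxOf 0 = p := ⟨_, rfl⟩
  simp only [hpd] at hp hp0 hpos
  have hchain : IsValley l ↔ (∀ j (h : j + 1 < p), l[j + 1] < l[j]) ∧
      (∀ j (h : p + j + 1 < l.length), l[p + j] < l[p + j + 1]) := by
    have e1 : (l.take p).SortedGT ↔ ∀ j (h : j + 1 < p), l[j + 1] < l[j] := by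
      rw [List.sortedGT_iff_isChain, List.isChain_iff_getElem]
      simp only [List.length_take, List.getElem_take]
      exact ⟨fun h j hj => h j (by omega), fun h j hj => h j (by omega)⟩
    have e2 : (l.drop p).SortedLT ↔
        ∀ j (h : p + j + 1 < l.length), l[p + j] < l[p + j + 1] := by
      rw [List.sortedLT_iff_isChain, List.isChain_iff_getElem]
      simp only [List.length_drop, List.getElem_drop]
      exact ⟨fun h j hj => h j (by omega), fun h j hj => h j (by omega)⟩
    rw [← e1, ← e2, ← hpd]
    exact ⟨fun h => ⟨h.2, h.3⟩, fun h => ⟨hl, h.1, h.2⟩⟩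
  rw [hchain]
  constructor
  · rintro ⟨hdec, hinc⟩
    have down : ∀ j (h : j < p), l[j + 1] < l[j] := fun j h => by
      obtain h' | h' := lt_or_eq_of_le (show j + 1 ≤ p from h)
      · exact hdec j h'
      · subst h'
        have := hpos j h
        omega
    have up : ∀ j (hj : p ≤ j) (h : j + 1 < l.length), l[j] < l[j + 1] := fun j hj h => by
      obtain ⟨d, rfl⟩ := Nat.exists_eq_add_of_le hj
      exact hinc d h
    refine ⟨fun j h hlt => ?_, fun j h => ?_⟩
    · obtain hj | hj := lt_or_ge j p
      · exact absurd (down j hj) hlt.not_gt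
      · exact (up (j + 1) (by omega) h).le
    · obtain hj | hj := lt_or_ge j p
      · exact (down j hj).ne'
      · exact (up j hj h).ne
  · rintro ⟨hpeak, htie⟩
    constructor
    · have down : ∀ d j, (hd : j + 1 + d = p) → l[j + 1] < l[j] := by
        intro d
        induction d with
        | zero =>
          rintro j rfl
          have := hpos j (by omega)
          simp only [add_zero] at hp0
          omega
        | succ d ih =>
          intro j hd
          have h1 := ih (j + 1) (by omega)
          have h2 := htie j (by omega)
          have h3 := hpeak j (by omega)
          have : l[j + 1 + 1] = l[j + 2] := rfl
          omega
      exact fun j h => down (p - (j + 1)) j (by omega)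
    · intro j
      induction j with
      | zero =>
        intro h
        have := htie p h
        simp only [add_zero] at *
        omega
      | succ j ih =>
        intro h
        have h1 := ih (by omega)
        have h2 := htie (p + j + 1) h
        exact lt_of_le_of_ne (hpeak (p + j) h h1) h2

theorem IsPF.zero_mem_valueWord {n : ℕ} (hn : 1 ≤ n) {f : Fin n → Fin n} (hf : IsPF f) :
    0 ∈ valueWord f := by
  have := (isPF_iff_forall_le_card f).1 hf 1 hn
  obtain ⟨j, hj⟩ := card_pos.1 this
  rw [valueWord, List.mem_ofFn']
  exact ⟨j, by simpa using hj⟩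

theorem IsPF.isValley_valueWord_iff {n : ℕ} (hn : 1 ≤ n) {f : Fin n → Fin n} (hf : IsPF f) :
    IsValley (valueWord f) ↔ peakSet f = ∅ ∧ tieSet f = ∅ := by
  rw [isValley_iff (hf.zero_mem_valueWord hn), peakSet_eq_empty_iff, tieSet_eq_empty_iff]

theorem IsValley.valleySplit_valueWord_mem_iff {n : ℕ} (hn : 1 ≤ n) {f : Fin n → Fin n}
    (hf : IsValley (valueWord f)) {i : ℕ} :
    valleySplit (valueWord f) ∈ valleyPairsMax n 0 i ↔
      IsPF f ∧ (f ⟨n - 1, Nat.sub_one_lt_of_le hn le_rfl⟩ : ℕ) = i := by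
  have hlen : (valueWord f).length = n := by simp [valueWord]
  have hlt : ∀ x ∈ valueWord f, x < n := by simp [valueWord, List.mem_ofFn']
  have hlast : (valueWord f).getLast? = some (f ⟨n - 1, Nat.sub_one_lt_of_le hn le_rfl⟩ : ℕ) := by
    rw [List.getLast?_eq_some_getLast (List.ne_nil_of_mem hf.zero_mem)]
    simp only [valueWord, List.getLast_ofFn]
  simp only [hf.valleySplit_mem_iff, hlen, hlast, countP_valueWord, isPF_iff_forall_le_card,
    Option.some_inj, true_and]
  exact and_iff_right hlt

theorem valueWord_injective {n : ℕ} : Function.Injective (valueWord : (Fin n → Fin n) → List ℕ) :=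
  fun _ _ h => funext fun j => Fin.ext (congrFun (List.ofFn_injective h) j)

theorem exists_valueWord_eq {n : ℕ} {l : List ℕ} (hlen : l.length = n) (hl : ∀ x ∈ l, x < n) :
    ∃ f : Fin n → Fin n, valueWord f = l := by
  subst hlen
  exact ⟨fun j => ⟨l[j], hl _ (List.getElem_mem _)⟩, List.ofFn_getElem⟩

/-- For `i ∈ [n]`, the number of peakless-tieless parking functions of length `n`
whose last entry equals `i` is the Catalan triangle entry `C_{n,i}`. -/
theorem stmt9 (n i : ℕ) (hn : 1 ≤ n) (hi : i ∈ Finset.Icc 1 n) :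
    (Finset.univ.filter (fun f : Fin n → Fin n =>
        IsPF f ∧ peakSet f = ∅ ∧ tieSet f = ∅ ∧
        (f ⟨n - 1, by omega⟩ : ℕ) + 1 = i)).card = catTri n i := by
  obtain ⟨hi1, hin⟩ := Finset.mem_Icc.1 hi
  obtain ⟨i, rfl⟩ := Nat.exists_eq_add_of_le' hi1
  rw [← card_valleyPairsMax_eq_catTri hin]
  refine Finset.card_bij (fun f _ => valleySplit (valueWord f)) ?_ ?_ ?_
  · intro f hf
    obtain ⟨-, hpf, hpeak, htie, hlast⟩ := Finset.mem_filter.1 hf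
    have hv := (hpf.isValley_valueWord_iff hn).2 ⟨hpeak, htie⟩
    exact (hv.valleySplit_valueWord_mem_iff hn).2 ⟨hpf, Nat.succ_injective hlast⟩
  · intro f hf g hg hfg
    obtain ⟨-, hf, hfp, hft, -⟩ := Finset.mem_filter.1 hf
    obtain ⟨-, hg, hgp, hgt, -⟩ := Finset.mem_filter.1 hg
    exact valueWord_injective (((hf.isValley_valueWord_iff hn).2 ⟨hfp, hft⟩).ext
      ((hg.isValley_valueWord_iff hn).2 ⟨hgp, hgt⟩) hfg)
  · rintro ⟨A, B⟩ hP
    have hm := mem_valleyPairs.1 (Finset.mem_filter.1 hP).1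
    obtain ⟨l, hl, hs⟩ := exists_isValley_valleySplit_eq hm.2.2.1 hm.2.2.2.1
    rw [← hs] at hP ⊢
    obtain ⟨hlen, hlt, -⟩ := hl.valleySplit_mem_iff.1 hP
    obtain ⟨f, rfl⟩ := exists_valueWord_eq hlen hlt
    obtain ⟨hpf, hlast⟩ := (hl.valleySplit_valueWord_mem_iff hn).1 hP
    have hpt := (hpf.isValley_valueWord_iff hn).1 hl
    exact ⟨f, Finset.mem_filter.2 ⟨Finset.mem_univ f, hpf, hpt.1, hpt.2, congrArg (· + 1) hlast⟩,
      rfl⟩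
end
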